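/- In Version C, consider a position in which every pile has size at most 3, with a₁ piles of size 1, a₂ piles of size 2, and a₃ piles of size 3. It is a P-position if and only if one of the following holds: (1) a₁ = 0 and a₃ = 0; (2) (a₁, a₂, a₃) is one of (0,1,3), (0,2,3), (1,0,2), (1,0,5), (2,0,1); (3) a₁ + 2·a₂ ≡ 0 (mod 3), and (a₁, a₂, a₃) is not of any of the following exceptional forms: (a₁, a₂, a₃) = (0, 3k, e) with k ≥ 0 and e ∈ {1,2}; (a₁, a₂, a₃) = (1, 3k+1, e) with k ≥ 0 and e ∈ {0,1}; (a₁, a₂, a₃) = (2, 3k+2, 0) with k ≥ 0; or (a₁, a₂, a₃) one of (0,0,4), (0,0,5), (1,1,2), (1,1,3), (1,1,4), (1,1,5), (2,2,3), (3,0,1), (3,0,2), (3,0,5). -/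

import Mathlib

/-- Remove one token from a pile of size `p` in `G`: delete one copy of `p` and,
if `p ≠ 1`, add back a pile of size `p - 1`. -/
def takeOne (G : Multiset ℕ) (p : ℕ) : Multiset ℕ :=
  G.erase p + (if p = 1 then (0 : Multiset ℕ) else {p - 1})

/-- Legal moves of Version C: remove one token from one chosen pile, or choose two
piles (counted with multiplicity) and remove one token from each of them
(piles reaching size 0 are deleted). -/
inductive MoveC : Multiset ℕ → Multiset ℕ → Prop
  | one {G : Multiset ℕ} {p : ℕ} (hp : p ∈ G) (h1 : 1 ≤ p) : MoveC G (takeOne G p)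
  | two {G : Multiset ℕ} {p q : ℕ} (hp : p ∈ G) (hq : q ∈ G.erase p)
      (h1 : 1 ≤ p) (h2 : 1 ≤ q) : MoveC G (takeOne (takeOne G p) q)

mutual
  /-- P-positions of Version C under normal play: every move leads to an N-position
  (in particular the empty position is a P-position).  Since every move strictly
  decreases the total number of tokens, this inductive definition agrees with the
  usual recursive definition of outcome classes. -/
  inductive PPosC : Multiset ℕ → Prop
    | mk : ∀ {G : Multiset ℕ}, (∀ H, MoveC G H → NPosC H) → PPosC G
  /-- N-positions of Version C under normal play: some move leads to a P-position. -/
  inductive NPosC : Multiset ℕ → Prop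
    | mk : ∀ {G H : Multiset ℕ}, MoveC G H → PPosC H → NPosC G
end

/-- The position with `a` piles of size 1, `b` piles of size 2 and `c` piles of size 3. -/
def smallPos (a b c : ℕ) : Multiset ℕ :=
  Multiset.replicate a 1 + Multiset.replicate b 2 + Multiset.replicate c 3

/-- The arithmetic description of the P-positions among the positions `smallPos a b c`. -/
def IsSmallP (a b c : ℕ) : Prop :=
  (a = 0 ∧ c = 0) ∨
  (a = 0 ∧ b = 1 ∧ c = 3) ∨ (a = 0 ∧ b = 2 ∧ c = 3) ∨ (a = 1 ∧ b = 0 ∧ c = 2) ∨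
  (a = 1 ∧ b = 0 ∧ c = 5) ∨ (a = 2 ∧ b = 0 ∧ c = 1) ∨
  ((a + 2 * b) % 3 = 0 ∧
    ¬ (a = 0 ∧ b % 3 = 0 ∧ (c = 1 ∨ c = 2)) ∧
    ¬ (a = 1 ∧ b % 3 = 1 ∧ c ≤ 1) ∧
    ¬ (a = 2 ∧ b % 3 = 2 ∧ c = 0) ∧
    ¬ (a = 0 ∧ b = 0 ∧ (c = 4 ∨ c = 5)) ∧
    ¬ (a = 1 ∧ b = 1 ∧ 2 ≤ c ∧ c ≤ 5) ∧
    ¬ (a = 2 ∧ b = 2 ∧ c = 3) ∧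
    ¬ (a = 3 ∧ b = 0 ∧ (c = 1 ∨ c = 2 ∨ c = 5)))

theorem PPosC.not_NPosC {G : Multiset ℕ} (h : PPosC G) : ¬ NPosC G := by
  refine PPosC.rec (motive_1 := fun G _ => ¬ NPosC G) (motive_2 := fun G _ => ¬ PPosC G)
    ?_ ?_ h
  · rintro G - ih ⟨hm, hp⟩
    exact ih _ hm hp
  · rintro G H hm - ih ⟨hG⟩
    exact ih (hG H hm)

theorem smallPos_succ_one (a b c : ℕ) : smallPos (a + 1) b c = 1 ::ₘ smallPos a b c := by
  simp [smallPos, Multiset.replicate_succ]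

theorem smallPos_succ_two (a b c : ℕ) : smallPos a (b + 1) c = 2 ::ₘ smallPos a b c := by
  simp [smallPos, Multiset.replicate_succ]

theorem smallPos_succ_three (a b c : ℕ) : smallPos a b (c + 1) = 3 ::ₘ smallPos a b c := by
  simp [smallPos, Multiset.replicate_succ]

theorem takeOne_cons_one (G : Multiset ℕ) : takeOne (1 ::ₘ G) 1 = G := by
  simp [takeOne]

theorem takeOne_cons_of_ne {p : ℕ} (hp : p ≠ 1) (G : Multiset ℕ) :
    takeOne (p ::ₘ G) p = (p - 1) ::ₘ G := by
  simp [takeOne, hp, add_comm G]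

theorem takeOne_smallPos_one (a b c : ℕ) :
    takeOne (smallPos (a + 1) b c) 1 = smallPos a b c := by
  rw [smallPos_succ_one, takeOne_cons_one]

theorem takeOne_smallPos_two (a b c : ℕ) :
    takeOne (smallPos a (b + 1) c) 2 = smallPos (a + 1) b c := by
  rw [smallPos_succ_two, takeOne_cons_of_ne (by norm_num), smallPos_succ_one]

theorem takeOne_smallPos_three (a b c : ℕ) :
    takeOne (smallPos a b (c + 1)) 3 = smallPos a (b + 1) c := by
  rw [smallPos_succ_three, takeOne_cons_of_ne (by norm_num), smallPos_succ_two]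

theorem mem_smallPos {a b c p : ℕ} :
    p ∈ smallPos a b c ↔ (a ≠ 0 ∧ p = 1) ∨ (b ≠ 0 ∧ p = 2) ∨ (c ≠ 0 ∧ p = 3) := by
  simp [smallPos, Multiset.mem_replicate, or_assoc]

/-- The moves of Version C on positions with piles of size at most 3, in terms of the numbers
of piles of each size. -/
inductive SmallMove : ℕ → ℕ → ℕ → ℕ → ℕ → ℕ → Prop
  | one (a b c : ℕ) : SmallMove (a + 1) b c a b c
  | two (a b c : ℕ) : SmallMove a (b + 1) c (a + 1) b c
  | three (a b c : ℕ) : SmallMove a b (c + 1) a (b + 1) c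
  | one_one (a b c : ℕ) : SmallMove (a + 2) b c a b c
  | one_two (a b c : ℕ) : SmallMove (a + 1) (b + 1) c (a + 1) b c
  | one_three (a b c : ℕ) : SmallMove (a + 1) b (c + 1) a (b + 1) c
  | two_two (a b c : ℕ) : SmallMove a (b + 2) c (a + 2) b c
  | two_three (a b c : ℕ) : SmallMove a (b + 1) (c + 1) (a + 1) (b + 1) c
  | three_three (a b c : ℕ) : SmallMove a b (c + 2) a (b + 2) c

theorem SmallMove.moveC {a b c a' b' c' : ℕ} (h : SmallMove a b c a' b' c') :
    MoveC (smallPos a b c) (smallPos a' b' c') := by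
  induction h with
  | one a b c =>
    rw [← takeOne_smallPos_one a b c]
    exact .one (by simp [mem_smallPos]) (by norm_num)
  | two a b c =>
    rw [← takeOne_smallPos_two a b c]
    exact .one (by simp [mem_smallPos]) (by norm_num)
  | three a b c =>
    rw [← takeOne_smallPos_three a b c]
    exact .one (by simp [mem_smallPos]) (by norm_num)
  | one_one a b c =>
    rw [← takeOne_smallPos_one a b c,
      ← takeOne_smallPos_one (a + 1) b c]
    exact .two (by simp [mem_smallPos])
      (by rw [smallPos_succ_one, Multiset.erase_cons_head]; simp [mem_smallPos])
      (by norm_num) (by norm_num)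
  | one_two a b c =>
    rw [← takeOne_smallPos_two a b c,
      ← takeOne_smallPos_one a (b + 1) c]
    exact .two (by simp [mem_smallPos])
      (by rw [smallPos_succ_one, Multiset.erase_cons_head]; simp [mem_smallPos])
      (by norm_num) (by norm_num)
  | one_three a b c =>
    rw [← takeOne_smallPos_three a b c,
      ← takeOne_smallPos_one a b (c + 1)]
    exact .two (by simp [mem_smallPos])
      (by rw [smallPos_succ_one, Multiset.erase_cons_head]; simp [mem_smallPos])
      (by norm_num) (by norm_num)
  | two_two a b c =>
    rw [← takeOne_smallPos_two (a + 1) b c,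
      ← takeOne_smallPos_two a (b + 1) c]
    exact .two (by simp [mem_smallPos])
      (by rw [smallPos_succ_two, Multiset.erase_cons_head]; simp [mem_smallPos])
      (by norm_num) (by norm_num)
  | two_three a b c =>
    rw [← takeOne_smallPos_three (a + 1) b c,
      ← takeOne_smallPos_two a b (c + 1)]
    exact .two (by simp [mem_smallPos])
      (by rw [smallPos_succ_two, Multiset.erase_cons_head]; simp [mem_smallPos])
      (by norm_num) (by norm_num)
  | three_three a b c =>
    rw [← takeOne_smallPos_three a (b + 1) c,
      ← takeOne_smallPos_three a b (c + 1)]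
    exact .two (by simp [mem_smallPos])
      (by rw [smallPos_succ_three, Multiset.erase_cons_head]; simp [mem_smallPos])
      (by norm_num) (by norm_num)

theorem MoveC.exists_smallMove {a b c : ℕ} {H : Multiset ℕ} (h : MoveC (smallPos a b c) H) :
    ∃ a' b' c', SmallMove a b c a' b' c' ∧ H = smallPos a' b' c' := by
  cases h with
  | one hp =>
    rcases mem_smallPos.1 hp with ⟨h0, rfl⟩ | ⟨h0, rfl⟩ | ⟨h0, rfl⟩ <;>
      obtain ⟨n, rfl⟩ := Nat.exists_eq_succ_of_ne_zero h0
    · exact ⟨_, _, _, .one n b c, takeOne_smallPos_one n b c⟩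
    · exact ⟨_, _, _, .two a n c, takeOne_smallPos_two a n c⟩
    · exact ⟨_, _, _, .three a b n, takeOne_smallPos_three a b n⟩
  | two hp hq =>
    rcases mem_smallPos.1 hp with ⟨h0, rfl⟩ | ⟨h0, rfl⟩ | ⟨h0, rfl⟩ <;>
      obtain ⟨n, rfl⟩ := Nat.exists_eq_succ_of_ne_zero h0 <;> simp only [Nat.succ_eq_add_one] at *
    · rw [smallPos_succ_one, Multiset.erase_cons_head] at hq
      rw [takeOne_smallPos_one]
      rcases mem_smallPos.1 hq with ⟨h0, rfl⟩ | ⟨h0, rfl⟩ | ⟨h0, rfl⟩ <;>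
        obtain ⟨m, rfl⟩ := Nat.exists_eq_succ_of_ne_zero h0
      · exact ⟨_, _, _, .one_one m b c, takeOne_smallPos_one m b c⟩
      · exact ⟨_, _, _, .one_two n m c, takeOne_smallPos_two n m c⟩
      · exact ⟨_, _, _, .one_three n b m, takeOne_smallPos_three n b m⟩
    · rw [smallPos_succ_two, Multiset.erase_cons_head] at hq
      rw [takeOne_smallPos_two]
      rcases mem_smallPos.1 hq with ⟨h0, rfl⟩ | ⟨h0, rfl⟩ | ⟨h0, rfl⟩ <;>
        obtain ⟨m, rfl⟩ := Nat.exists_eq_succ_of_ne_zero h0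
      · exact ⟨_, _, _, .one_two m n c, takeOne_smallPos_one (m + 1) n c⟩
      · exact ⟨_, _, _, .two_two a m c, takeOne_smallPos_two (a + 1) m c⟩
      · exact ⟨_, _, _, .two_three a n m, takeOne_smallPos_three (a + 1) n m⟩
    · rw [smallPos_succ_three, Multiset.erase_cons_head] at hq
      rw [takeOne_smallPos_three]
      rcases mem_smallPos.1 hq with ⟨h0, rfl⟩ | ⟨h0, rfl⟩ | ⟨h0, rfl⟩ <;>
        obtain ⟨m, rfl⟩ := Nat.exists_eq_succ_of_ne_zero h0
      · exact ⟨_, _, _, .one_three m b n, takeOne_smallPos_one m (b + 1) n⟩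
      · exact ⟨_, _, _, .two_three a m n, takeOne_smallPos_two a (m + 1) n⟩
      · exact ⟨_, _, _, .three_three a b m, takeOne_smallPos_three a (b + 1) m⟩

theorem SmallMove.size_lt {a b c a' b' c' : ℕ} (h : SmallMove a b c a' b' c') :
    a' + 2 * b' + 3 * c' < a + 2 * b + 3 * c := by
  cases h <;> omega

set_option maxHeartbeats 2000000 in
theorem SmallMove.not_isSmallP {a b c a' b' c' : ℕ} (h : SmallMove a b c a' b' c')
    (hP : IsSmallP a b c) : ¬ IsSmallP a' b' c' := by
  intro hQ
  induction h <;> rcases hP with h | h | h | h | h | h | ⟨h, hE⟩ <;>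
    rcases hQ with h' | h' | h' | h' | h' | h' | ⟨h', hE'⟩ <;> omega

instance (a b c : ℕ) : Decidable (IsSmallP a b c) := by
  unfold IsSmallP; infer_instance

theorem isSmallP_iff_of_four_le {a b c : ℕ} (h : 4 ≤ a) :
    IsSmallP a b c ↔ (a + 2 * b) % 3 = 0 := by
  unfold IsSmallP; omega

theorem isSmallP_iff_of_six_le {a b c : ℕ} (h : 6 ≤ c) :
    IsSmallP a b c ↔ (a + 2 * b) % 3 = 0 := by
  unfold IsSmallP; omega

theorem isSmallP_iff_of_three_le {a b c : ℕ} (h : 3 ≤ b) :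
    IsSmallP a b c ↔ (a = 0 ∧ c = 0) ∨ ((a + 2 * b) % 3 = 0 ∧ ¬ (a = 0 ∧ c ≤ 2) ∧
      ¬ (a = 1 ∧ c ≤ 1) ∧ ¬ (a = 2 ∧ c = 0)) := by
  unfold IsSmallP; omega

/-- Some move from `smallPos a b c` leads to a position satisfying `IsSmallP`. -/
def CanReachSmallP (a b c : ℕ) : Prop :=
  (1 ≤ a ∧ IsSmallP (a - 1) b c) ∨
  (1 ≤ b ∧ IsSmallP (a + 1) (b - 1) c) ∨
  (1 ≤ c ∧ IsSmallP a (b + 1) (c - 1)) ∨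
  (2 ≤ a ∧ IsSmallP (a - 2) b c) ∨
  ((1 ≤ a ∧ 1 ≤ c) ∧ IsSmallP (a - 1) (b + 1) (c - 1)) ∨
  ((1 ≤ a ∧ 1 ≤ b) ∧ IsSmallP a (b - 1) c) ∨
  (2 ≤ b ∧ IsSmallP (a + 2) (b - 2) c) ∨
  ((1 ≤ b ∧ 1 ≤ c) ∧ IsSmallP (a + 1) b (c - 1)) ∨
  (2 ≤ c ∧ IsSmallP a (b + 2) (c - 2))

instance (a b c : ℕ) : Decidable (CanReachSmallP a b c) := by
  unfold CanReachSmallP; infer_instance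

theorem CanReachSmallP.exists_smallMove {a b c : ℕ} (h : CanReachSmallP a b c) :
    ∃ a' b' c', SmallMove a b c a' b' c' ∧ IsSmallP a' b' c' := by
  rcases h with ⟨ha, h⟩ | ⟨hb, h⟩ | ⟨hc, h⟩ | ⟨ha, h⟩ | ⟨⟨ha, hc⟩, h⟩ | ⟨⟨ha, hb⟩, h⟩ |
    ⟨hb, h⟩ | ⟨⟨hb, hc⟩, h⟩ | ⟨hc, h⟩
  · obtain ⟨a, rfl⟩ := Nat.exists_eq_add_of_le' ha
    exact ⟨_, _, _, .one a b c, h⟩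
  · obtain ⟨b, rfl⟩ := Nat.exists_eq_add_of_le' hb
    exact ⟨_, _, _, .two a b c, h⟩
  · obtain ⟨c, rfl⟩ := Nat.exists_eq_add_of_le' hc
    exact ⟨_, _, _, .three a b c, h⟩
  · obtain ⟨a, rfl⟩ := Nat.exists_eq_add_of_le' ha
    exact ⟨_, _, _, .one_one a b c, h⟩
  · obtain ⟨a, rfl⟩ := Nat.exists_eq_add_of_le' ha
    obtain ⟨c, rfl⟩ := Nat.exists_eq_add_of_le' hc
    exact ⟨_, _, _, .one_three a b c, h⟩
  · obtain ⟨a, rfl⟩ := Nat.exists_eq_add_of_le' ha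
    obtain ⟨b, rfl⟩ := Nat.exists_eq_add_of_le' hb
    exact ⟨_, _, _, .one_two a b c, h⟩
  · obtain ⟨b, rfl⟩ := Nat.exists_eq_add_of_le' hb
    exact ⟨_, _, _, .two_two a b c, h⟩
  · obtain ⟨b, rfl⟩ := Nat.exists_eq_add_of_le' hb
    obtain ⟨c, rfl⟩ := Nat.exists_eq_add_of_le' hc
    exact ⟨_, _, _, .two_three a b c, h⟩
  · obtain ⟨c, rfl⟩ := Nat.exists_eq_add_of_le' hc
    exact ⟨_, _, _, .three_three a b c, h⟩

theorem canReachSmallP_of_six_le {a b c : ℕ} (ha : 6 ≤ a) (hN : ¬ IsSmallP a b c) :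
    CanReachSmallP a b c := by
  rw [isSmallP_iff_of_four_le (by omega)] at hN
  have h1 := isSmallP_iff_of_four_le (a := a - 1) (b := b) (c := c) (by omega)
  have h2 := isSmallP_iff_of_four_le (a := a - 2) (b := b) (c := c) (by omega)
  unfold CanReachSmallP
  by_cases hr : (a + 2 * b) % 3 = 1
  · exact .inl ⟨by omega, h1.2 (by omega)⟩
  · exact .inr (.inr (.inr (.inl ⟨by omega, h2.2 (by omega)⟩)))

theorem canReachSmallP_of_eight_le {a b c : ℕ} (hc : 8 ≤ c) (hN : ¬ IsSmallP a b c) :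
    CanReachSmallP a b c := by
  rw [isSmallP_iff_of_six_le (by omega)] at hN
  have h1 := isSmallP_iff_of_six_le (a := a) (b := b + 1) (c := c - 1) (by omega)
  have h2 := isSmallP_iff_of_six_le (a := a) (b := b + 2) (c := c - 2) (by omega)
  unfold CanReachSmallP
  by_cases hr : (a + 2 * b) % 3 = 1
  · exact .inr (.inr (.inl ⟨by omega, h1.2 (by omega)⟩))
  · exact .inr (.inr (.inr (.inr (.inr (.inr (.inr (.inr ⟨by omega, h2.2 (by omega)⟩)))))))

theorem canReachSmallP_of_five_le {a b c : ℕ} (hb : 5 ≤ b) (hN : ¬ IsSmallP a b c) :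
    CanReachSmallP a b c := by
  unfold CanReachSmallP
  simp only [isSmallP_iff_of_three_le (show 3 ≤ b by omega),
    isSmallP_iff_of_three_le (show 3 ≤ b - 1 by omega),
    isSmallP_iff_of_three_le (show 3 ≤ b - 2 by omega),
    isSmallP_iff_of_three_le (show 3 ≤ b + 1 by omega),
    isSmallP_iff_of_three_le (show 3 ≤ b + 2 by omega)] at hN ⊢
  obtain ⟨k, rfl | rfl | rfl⟩ : ∃ k, b = 3 * k ∨ b = 3 * k + 1 ∨ b = 3 * k + 2 :=
    ⟨b / 3, by omega⟩
  all_goals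
    rcases a with _ | _ | _ | a <;> rcases c with _ | _ | _ | c <;> simp at hN ⊢ <;> omega

set_option maxRecDepth 100000 in
set_option maxHeartbeats 2000000 in
theorem canReachSmallP_of_lt :
    ∀ a < 6, ∀ b < 5, ∀ c < 8, ¬ IsSmallP a b c → CanReachSmallP a b c := by
  decide

theorem exists_smallMove_isSmallP {a b c : ℕ} (hN : ¬ IsSmallP a b c) :
    ∃ a' b' c', SmallMove a b c a' b' c' ∧ IsSmallP a' b' c' := by
  refine CanReachSmallP.exists_smallMove ?_
  rcases le_or_gt 6 a with ha | ha
  · exact canReachSmallP_of_six_le ha hN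
  rcases le_or_gt 8 c with hc | hc
  · exact canReachSmallP_of_eight_le hc hN
  rcases le_or_gt 5 b with hb | hb
  · exact canReachSmallP_of_five_le hb hN
  · exact canReachSmallP_of_lt a ha b hb c hc hN

theorem smallPos_outcome (a b c : ℕ) :
    (IsSmallP a b c → PPosC (smallPos a b c)) ∧ (¬ IsSmallP a b c → NPosC (smallPos a b c)) := by
  induction hn : a + 2 * b + 3 * c using Nat.strong_induction_on generalizing a b c with
  | _ n ih =>
    refine ⟨fun hP => .mk fun H hH => ?_, fun hN => ?_⟩
    · obtain ⟨a', b', c', hm, rfl⟩ := hH.exists_smallMove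
      exact (ih _ (hn ▸ hm.size_lt) a' b' c' rfl).2 (hm.not_isSmallP hP)
    · obtain ⟨a', b', c', hm, hP⟩ := exists_smallMove_isSmallP hN
      exact .mk hm.moveC ((ih _ (hn ▸ hm.size_lt) a' b' c' rfl).1 hP)

theorem PPosC_smallPos_iff (a b c : ℕ) : PPosC (smallPos a b c) ↔ IsSmallP a b c := by
  refine ⟨fun h => ?_, (smallPos_outcome a b c).1⟩
  by_contra hN
  exact h.not_NPosC ((smallPos_outcome a b c).2 hN)

/-- In Version C, the classification of P-positions in which every pile has size at
most 3, with `a1` piles of size 1, `a2` piles of size 2 and `a3` piles of size 3. -/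
theorem versionC_piles_le_three (a1 a2 a3 : ℕ) :
    PPosC (Multiset.replicate a1 1 + Multiset.replicate a2 2 + Multiset.replicate a3 3) ↔
      (a1 = 0 ∧ a3 = 0) ∨
      ((a1, a2, a3) = (0, 1, 3) ∨ (a1, a2, a3) = (0, 2, 3) ∨ (a1, a2, a3) = (1, 0, 2) ∨
        (a1, a2, a3) = (1, 0, 5) ∨ (a1, a2, a3) = (2, 0, 1)) ∨
      ((a1 + 2 * a2) % 3 = 0 ∧
        ¬ ((∃ k, a1 = 0 ∧ a2 = 3 * k ∧ (a3 = 1 ∨ a3 = 2)) ∨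
           (∃ k, a1 = 1 ∧ a2 = 3 * k + 1 ∧ (a3 = 0 ∨ a3 = 1)) ∨
           (∃ k, a1 = 2 ∧ a2 = 3 * k + 2 ∧ a3 = 0) ∨
           (a1, a2, a3) = (0, 0, 4) ∨ (a1, a2, a3) = (0, 0, 5) ∨
           (a1, a2, a3) = (1, 1, 2) ∨ (a1, a2, a3) = (1, 1, 3) ∨
           (a1, a2, a3) = (1, 1, 4) ∨ (a1, a2, a3) = (1, 1, 5) ∨
           (a1, a2, a3) = (2, 2, 3) ∨ (a1, a2, a3) = (3, 0, 1) ∨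
           (a1, a2, a3) = (3, 0, 2) ∨ (a1, a2, a3) = (3, 0, 5))) := by
  have hk (n r : ℕ) (hr : r < 3) : (∃ k, n = 3 * k + r) ↔ n % 3 = r :=
    ⟨by rintro ⟨k, rfl⟩; omega, fun h => ⟨n / 3, by omega⟩⟩
  have h0 := hk a2 0 (by norm_num)
  simp only [add_zero] at h0
  refine (PPosC_smallPos_iff a1 a2 a3).trans ?_
  simp only [IsSmallP, Prod.mk.injEq, exists_and_left, exists_and_right, h0,
    hk a2 1 (by norm_num), hk a2 2 (by norm_num)]
  rcases a1 with _ | _ | _ | _ | a1 <;> rcases a3 with _ | _ | _ | _ | _ | _ | a3 <;>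
    simp
  all_goals omega
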